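/- A real number α in the interval [0,1] is left-c.e. if and only if α = Ω_M for some prefix-free machine M. -/

import Mathlib

open scoped Classical

/-- A set of binary strings is prefix-free if no element is a proper prefix of another. -/
def PrefixFreeSet (D : Set (List Bool)) : Prop :=
  ∀ σ ∈ D, ∀ τ ∈ D, σ <+: τ → σ = τ

/-- A prefix-free machine: a partial computable function on binary strings
whose domain is prefix-free. -/
structure PFMachine where
  f : List Bool →. List Bool
  partrec : Partrec f
  prefixFree : PrefixFreeSet {σ | (f σ).Dom}

/-- The halting probability `Ω_M = Σ_{σ ∈ dom M} 2^{-|σ|}` of a prefix-free machine. -/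
noncomputable def omegaOf (M : PFMachine) : ℝ :=
  ∑' σ : {σ : List Bool // (M.f σ).Dom}, (2 : ℝ) ^ (-(σ.1.length : ℤ))

/-- A computable nondecreasing sequence of rationals converging to `x`. -/
def LeftCEApprox (q : ℕ → ℚ) (x : ℝ) : Prop :=
  Computable q ∧ Monotone q ∧
    Filter.Tendsto (fun n => (q n : ℝ)) Filter.atTop (nhds x)

/-- A real is left-c.e. if some computable nondecreasing rational sequence converges to it. -/
def LeftCE (x : ℝ) : Prop := ∃ q : ℕ → ℚ, LeftCEApprox q x

/-- A real is right-c.e. if its negative is left-c.e. -/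
def RightCE (x : ℝ) : Prop := LeftCE (-x)

/-- Martin-Löf randomness of a real, via computable sequences of open rational intervals. -/
def MLRandom (x : ℝ) : Prop :=
  ∀ I : ℕ → ℕ → ℚ × ℚ, Computable₂ I →
    (∀ n : ℕ, MeasureTheory.volume
        (⋃ k : ℕ, Set.Ioo (((I n k).1 : ℝ)) (((I n k).2 : ℝ))) ≤ 2 ^ (-(n : ℤ))) →
    x ∉ ⋂ n : ℕ, ⋃ k : ℕ, Set.Ioo (((I n k).1 : ℝ)) (((I n k).2 : ℝ))

/-- A universal prefix-free machine: it simulates every prefix-free machine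
via a fixed prefix. -/
def UniversalPF (U : PFMachine) : Prop :=
  ∀ M : PFMachine, ∃ ρ : List Bool, ∀ σ : List Bool, U.f (ρ ++ σ) = M.f σ

/-- The `i`-th binary digit of a real (of its expansion not ending in all 1s). -/
noncomputable def rdigit (x : ℝ) (i : ℕ) : Bool := decide (⌊x * 2 ^ (i + 1)⌋ % 2 = 1)

/-- The first `n` binary digits of a real. -/
noncomputable def bits (x : ℝ) (n : ℕ) : List Bool := (List.range n).map (rdigit x)

/-- Prefix-free Kolmogorov complexity of `σ` with respect to machine `M`,
with value `⊤` if `σ` is not in the range. -/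
noncomputable def Kf (M : PFMachine) (σ : List Bool) : ℕ∞ :=
  ⨅ p : {p : List Bool // σ ∈ M.f p}, (p.1.length : ℕ∞)

/-- An optimal prefix-free machine: minimizes `K` up to additive constants. -/
def OptimalPF (V : PFMachine) : Prop :=
  ∀ M : PFMachine, ∃ c : ℕ, ∀ σ : List Bool, Kf V σ ≤ Kf M σ + c

/-- Solovay reducibility for left-c.e. reals. -/
def SolovayRed (α β : ℝ) : Prop :=
  ∃ c : ℚ, ∃ f : ℚ →. ℚ, Partrec f ∧
    ∀ q : ℚ, (q : ℝ) < β →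
      ∃ r ∈ f q, (r : ℝ) < α ∧ α - (r : ℝ) < (c : ℝ) * (β - (q : ℝ))

/-- `X` is computable from `Y` with oracle-use `h`. -/
def ComputableFromWithUse (X Y : ℝ) (h : ℕ → ℕ) : Prop :=
  ∃ Φ : List Bool →. List Bool, Partrec Φ ∧
    ∀ n : ℕ, Φ (bits Y (h n)) = Part.some (bits X n)


open Encodable

/-! ### Computability of numerators and denominators of rationals -/

/-- The code of a rational as the pair of its numerator and its denominator. -/
def ratCode (q : ℚ) : ℕ := Nat.pair (encode q.num) q.den

theorem eqv_rat_eq_countP (q : ℚ) :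
    Denumerable.eqv ℚ q = (List.range (ratCode q)).countP (· ∈ Set.range ratCode) := by
  refine Eq.trans (b := @List.countP _ (fun n => @decide _ (decidableRangeEncode ℚ n))
    (List.range (ratCode q))) rfl ?_
  congr!

theorem natAbs_eq_encode (z : ℤ) : z.natAbs = (encode z + 1) / 2 := by
  rcases z with n | n
  · change n = (2 * n + 1) / 2
    omega
  · change n + 1 = (2 * n + 1 + 1) / 2
    omega

theorem toNat_eq_encode (z : ℤ) :
    z.toNat = if encode z % 2 = 0 then encode z / 2 else 0 := by
  rcases z with n | n
  · change n = if (2 * n) % 2 = 0 then (2 * n) / 2 else 0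
    rw [if_pos (by omega)]
    omega
  · change 0 = if (2 * n + 1) % 2 = 0 then (2 * n + 1) / 2 else 0
    rw [if_neg (by omega)]

theorem ratCode_injective : Function.Injective ratCode := by
  intro p q h
  obtain ⟨h₁, h₂⟩ := Nat.pair_eq_pair.1 h
  exact Rat.ext (encode_injective h₁) h₂

theorem mem_range_ratCode (n : ℕ) :
    n ∈ Set.range ratCode ↔ 0 < n.unpair.2 ∧
      ∀ k < n.unpair.2 + 1, (n.unpair.1 + 1) / 2 % k = 0 → n.unpair.2 % k = 0 → k ≤ 1 := by
  constructor
  · rintro ⟨q, rfl⟩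
    simp only [ratCode, Nat.unpair_pair, ← natAbs_eq_encode]
    refine ⟨q.den_pos, fun k _ h₁ h₂ => ?_⟩
    have := Nat.dvd_gcd (Nat.dvd_of_mod_eq_zero h₁) (Nat.dvd_of_mod_eq_zero h₂)
    rw [q.reduced] at this
    exact Nat.le_of_dvd one_pos this
  · rintro ⟨h₀, h⟩
    obtain ⟨z, hz⟩ : ∃ z : ℤ, encode z = n.unpair.1 :=
      ⟨Denumerable.ofNat ℤ n.unpair.1, Denumerable.encode_ofNat _⟩
    rw [← hz, ← natAbs_eq_encode] at h
    have hg : Nat.gcd z.natAbs n.unpair.2 = 1 := by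
      have hpos : 0 < Nat.gcd z.natAbs n.unpair.2 := Nat.gcd_pos_of_pos_right _ h₀
      have hle := h _ (Nat.lt_succ_of_le (Nat.gcd_le_right z.natAbs h₀))
        (Nat.mod_eq_zero_of_dvd (Nat.gcd_dvd_left _ _))
        (Nat.mod_eq_zero_of_dvd (Nat.gcd_dvd_right _ _))
      omega
    refine ⟨⟨z, n.unpair.2, h₀.ne', hg⟩, ?_⟩
    simp only [ratCode, hz, Nat.pair_unpair]

theorem primrecPred_mem_range_ratCode : PrimrecPred (· ∈ Set.range ratCode) := by
  have hR : PrimrecRel fun (k n : ℕ) =>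
      (n.unpair.1 + 1) / 2 % k = 0 → n.unpair.2 % k = 0 → k ≤ 1 := by
    have h₁ : PrimrecPred fun p : ℕ × ℕ => (p.2.unpair.1 + 1) / 2 % p.1 = 0 :=
      Primrec.eq.comp
        (Primrec.nat_mod.comp
          (Primrec.nat_div.comp
            (Primrec.succ.comp (Primrec.fst.comp (Primrec.unpair.comp Primrec.snd)))
            (Primrec.const 2)) Primrec.fst) (Primrec.const 0)
    have h₂ : PrimrecPred fun p : ℕ × ℕ => p.2.unpair.2 % p.1 = 0 :=
      Primrec.eq.comp
        (Primrec.nat_mod.comp (Primrec.snd.comp (Primrec.unpair.comp Primrec.snd)) Primrec.fst)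
        (Primrec.const 0)
    have h₃ : PrimrecPred fun p : ℕ × ℕ => p.1 ≤ 1 :=
      Primrec.nat_le.comp Primrec.fst (Primrec.const 1)
    exact ((h₁.not.or (h₂.not.or h₃)).of_eq
      (q := fun p : ℕ × ℕ => (p.2.unpair.1 + 1) / 2 % p.1 = 0 → p.2.unpair.2 % p.1 = 0 → p.1 ≤ 1)
      fun p => by tauto).primrecRel
  have hd : Primrec fun n : ℕ => n.unpair.2 := Primrec.snd.comp Primrec.unpair
  exact ((Primrec.nat_lt.comp (Primrec.const 0) hd).and
    ((hR.forall_lt).comp (Primrec.succ.comp hd) Primrec.id)).of_eq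
    fun n => (mem_range_ratCode n).symm

theorem PrimrecPred.count {p : ℕ → Prop} [DecidablePred p] (hp : PrimrecPred p) :
    Primrec (Nat.count p) := by
  have h : Primrec₂ fun n c : ℕ => c + if p n then 1 else 0 :=
    Primrec.nat_add.comp Primrec.snd
      (Primrec.ite (hp.comp Primrec.fst) (Primrec.const 1) (Primrec.const 0))
  refine (Primrec.nat_rec₁ 0 h).of_eq fun n => ?_
  induction n with
  | zero => simp
  | succ n ih => rw [Nat.count_succ, ← ih]

theorem computable_ratCode : Computable ratCode := by
  have hP : ComputablePred fun x : ℚ × ℕ =>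
      x.2 ∈ Set.range ratCode ∧ Nat.count (· ∈ Set.range ratCode) x.2 = Denumerable.eqv ℚ x.1 :=
    ((primrecPred_mem_range_ratCode.comp Primrec.snd).and
      (Primrec.eq.comp (primrecPred_mem_range_ratCode.count.comp Primrec.snd)
        (Primrec.encode.comp Primrec.fst))).computablePred
  have hex : ∀ q : ℚ, ∃ n, n ∈ Set.range ratCode ∧
      Nat.count (· ∈ Set.range ratCode) n = Denumerable.eqv ℚ q :=
    fun q => ⟨ratCode q, ⟨q, rfl⟩, (eqv_rat_eq_countP q).symm⟩
  refine (Computable.find hP hex).of_eq fun q => ?_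
  obtain ⟨h₁, h₂⟩ := Nat.find_spec (hex q)
  exact Nat.count_injective h₁ ⟨q, rfl⟩ (h₂.trans (eqv_rat_eq_countP q))

theorem computable_rat_den : Computable Rat.den :=
  (Computable.snd.comp (Computable.unpair.comp computable_ratCode)).of_eq fun q => by
    simp [ratCode]

theorem computable_rat_num_toNat : Computable fun q : ℚ => q.num.toNat := by
  have h : Primrec fun n : ℕ => if n % 2 = 0 then n / 2 else 0 :=
    Primrec.ite (Primrec.eq.comp (Primrec.nat_mod.comp Primrec.id (Primrec.const 2))
      (Primrec.const 0)) (Primrec.nat_div.comp Primrec.id (Primrec.const 2)) (Primrec.const 0)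
  refine (h.to_comp.comp
    (Computable.fst.comp (Computable.unpair.comp computable_ratCode))).of_eq fun q => ?_
  simp only [ratCode, Nat.unpair_pair, toNat_eq_encode]

theorem computable_natCast_div {β : Type*} [Primcodable β] {a b : β → ℕ} (ha : Computable a)
    (hb : Computable b) (hb₀ : ∀ x, b x ≠ 0) : Computable fun x => (a x : ℚ) / (b x : ℚ) := by
  have hcode : ∀ (x : β) (q : ℚ), q = (a x : ℚ) / b x ↔
      encode q.num % 2 = 0 ∧ encode q.num * b x = 2 * a x * q.den := by
    intro x q
    have hb' : (b x : ℚ) ≠ 0 := by exact_mod_cast hb₀ x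
    have hd : (q.den : ℚ) ≠ 0 := by exact_mod_cast q.den_nz
    have hq : q = (a x : ℚ) / b x ↔ q.num * (b x : ℤ) = a x * q.den := by
      rw [← @Int.cast_inj ℚ]
      push_cast
      rw [← div_eq_div_iff hd hb', Rat.num_div_den]
    rw [hq]
    have hpos : 0 < b x := Nat.pos_of_ne_zero (hb₀ x)
    rcases q.num with n | n
    · change (n : ℤ) * b x = _ ↔ (2 * n) % 2 = 0 ∧ 2 * n * b x = _
      rw [mul_assoc, mul_assoc, mul_right_inj' two_ne_zero]
      constructor
      · exact fun h => ⟨by omega, by exact_mod_cast h⟩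
      · exact fun h => by exact_mod_cast h.2
    · change _ ↔ (2 * n + 1) % 2 = 0 ∧ _
      constructor
      · intro h
        have h₁ : Int.negSucc n * (b x : ℤ) < 0 :=
          mul_neg_of_neg_of_pos (Int.negSucc_lt_zero n) (by exact_mod_cast hpos)
        have h₂ : (0 : ℤ) ≤ a x * q.den := by positivity
        omega
      · rintro ⟨h, -⟩
        omega
  have hz : Computable fun p : β × ℕ => encode (Denumerable.ofNat ℚ p.2).num :=
    (Computable.fst.comp (Computable.unpair.comp (computable_ratCode.comp
      ((Computable.ofNat ℚ).comp Computable.snd)))).of_eq fun p => by simp [ratCode]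
  have hd : Computable fun p : β × ℕ => (Denumerable.ofNat ℚ p.2).den :=
    computable_rat_den.comp ((Computable.ofNat ℚ).comp Computable.snd)
  have hP : ComputablePred fun p : β × ℕ => Denumerable.ofNat ℚ p.2 = (a p.1 : ℚ) / b p.1 := by
    have h : PrimrecPred fun v : (ℕ × ℕ) × ℕ × ℕ =>
        v.1.1 % 2 = 0 ∧ v.1.1 * v.2.2 = 2 * v.2.1 * v.1.2 :=
      (Primrec.eq.comp (Primrec.nat_mod.comp (Primrec.fst.comp Primrec.fst) (Primrec.const 2))
        (Primrec.const 0)).and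
      (Primrec.eq.comp
        (Primrec.nat_mul.comp (Primrec.fst.comp Primrec.fst) (Primrec.snd.comp Primrec.snd))
        (Primrec.nat_mul.comp
          (Primrec.nat_mul.comp (Primrec.const 2) (Primrec.fst.comp Primrec.snd))
          (Primrec.snd.comp Primrec.fst)))
    have hc := h.decide.to_comp.comp (Computable.pair (Computable.pair hz hd)
      (Computable.pair (ha.comp Computable.fst) (hb.comp Computable.fst)))
    exact hc.computablePred.of_eq fun p => by
      simpa using (hcode p.1 (Denumerable.ofNat ℚ p.2)).symm
  have hex : ∀ x, ∃ n, Denumerable.ofNat ℚ n = (a x : ℚ) / b x :=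
    fun x => ⟨Denumerable.eqv ℚ _, (Denumerable.eqv ℚ).symm_apply_apply _⟩
  exact ((Computable.ofNat ℚ).comp (Computable.find hP hex)).of_eq fun x => Nat.find_spec (hex x)

/-! ### A prefix-free machine with a prescribed left-c.e. halting probability -/

/-- The natural number with a given binary expansion, most significant digit first. -/
def binVal (σ : List Bool) : ℕ := σ.foldl (fun s b => 2 * s + b.toNat) 0

theorem binVal_concat (σ : List Bool) (b : Bool) :
    binVal (σ ++ [b]) = 2 * binVal σ + b.toNat := by
  simp [binVal]

theorem binVal_append_bounds (σ τ : List Bool) :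
    binVal σ * 2 ^ τ.length ≤ binVal (σ ++ τ) ∧
      binVal (σ ++ τ) < (binVal σ + 1) * 2 ^ τ.length := by
  induction τ using List.reverseRecOn with
  | nil => simp
  | append_singleton τ b ih =>
    rw [← List.append_assoc, binVal_concat, List.length_append, List.length_singleton, pow_succ,
      ← mul_assoc, ← mul_assoc]
    have := b.toNat_lt
    omega

theorem primrec_binVal : Primrec binVal := by
  have h : Primrec₂ fun (_ : List Bool) (p : ℕ × Bool) => 2 * p.1 + p.2.toNat :=
    Primrec.nat_add.comp
      (Primrec.nat_mul.comp (Primrec.const 2) (Primrec.fst.comp Primrec.snd))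
      ((Primrec.dom_bool Bool.toNat).comp (Primrec.snd.comp Primrec.snd))
  exact Primrec.list_foldl Primrec.id (Primrec.const 0) h

/-- The binary expansion of length `n` of a natural number, most significant digit first. -/
def binStr : ℕ → ℕ → List Bool
  | 0, _ => []
  | n + 1, j => binStr n (j / 2) ++ [decide (j % 2 = 1)]

theorem length_binStr (n j : ℕ) : (binStr n j).length = n := by
  induction n generalizing j with
  | zero => rfl
  | succ n ih => simp [binStr, ih]

theorem binVal_binStr {n j : ℕ} (h : j < 2 ^ n) : binVal (binStr n j) = j := by
  induction n generalizing j with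
  | zero => simp_all [binStr, binVal]
  | succ n ih =>
    rw [binStr, binVal_concat, ih (by rw [pow_succ] at h; omega)]
    rcases Nat.mod_two_eq_zero_or_one j with h | h <;> simp [h] <;> omega

theorem binStr_binVal (σ : List Bool) : binStr σ.length (binVal σ) = σ := by
  induction σ using List.reverseRecOn with
  | nil => rfl
  | append_singleton σ b ih =>
    rw [List.length_append, List.length_singleton, binVal_concat, binStr]
    have h₁ : (2 * binVal σ + b.toNat) / 2 = binVal σ := by
      have := b.toNat_lt
      omega
    have h₂ : decide ((2 * binVal σ + b.toNat) % 2 = 1) = b := by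
      cases b <;> simp [Nat.add_mod]
    rw [h₁, h₂, ih]

/-- The numerator over `2 ^ n` of the term preceding `k n / 2 ^ n` in the sequence, or zero. -/
def dyadicLow (k : ℕ → ℕ) : ℕ → ℕ
  | 0 => 0
  | n + 1 => 2 * k n

theorem computable_dyadicLow {k : ℕ → ℕ} (hk : Computable k) : Computable (dyadicLow k) := by
  have h : Computable₂ fun (_ : ℕ) (n : ℕ) => 2 * k n :=
    Primrec.nat_double.to_comp.comp (hk.comp Computable.snd)
  refine (Computable.nat_casesOn Computable.id (Computable.const 0) h).of_eq fun n => ?_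
  cases n <;> rfl

/-- The strings whose dyadic intervals make up the increments of the sequence `k n / 2 ^ n`. -/
def dyadicDomain (k : ℕ → ℕ) : Set (List Bool) :=
  {σ | dyadicLow k σ.length ≤ binVal σ ∧ binVal σ < k σ.length}

theorem computablePred_dyadicDomain {k : ℕ → ℕ} (hk : Computable k) :
    ComputablePred (· ∈ dyadicDomain k) := by
  have h : PrimrecPred fun p : (ℕ × ℕ) × ℕ => p.1.1 ≤ p.1.2 ∧ p.1.2 < p.2 :=
    (Primrec.nat_le.comp (Primrec.fst.comp Primrec.fst) (Primrec.snd.comp Primrec.fst)).and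
      (Primrec.nat_lt.comp (Primrec.snd.comp Primrec.fst) Primrec.snd)
  have hc := h.decide.to_comp.comp (Computable.pair
    (Computable.pair ((computable_dyadicLow hk).comp Computable.list_length)
      primrec_binVal.to_comp) (hk.comp Computable.list_length))
  exact hc.computablePred.of_eq fun σ => by simp [dyadicDomain]

theorem pow_mul_le_of_two_mul_le {k : ℕ → ℕ} (hk : ∀ n, 2 * k n ≤ k (n + 1)) (m r : ℕ) :
    k m * 2 ^ r ≤ k (m + r) := by
  induction r with
  | zero => simp
  | succ r ih =>
    have := hk (m + r)
    rw [pow_succ, ← mul_assoc, ← add_assoc]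
    omega

theorem prefixFreeSet_dyadicDomain {k : ℕ → ℕ} (hk : ∀ n, 2 * k n ≤ k (n + 1)) :
    PrefixFreeSet (dyadicDomain k) := by
  rintro σ ⟨-, hσ⟩ τ ⟨hτ, -⟩ ⟨ρ, rfl⟩
  rcases ρ with _ | ⟨b, ρ⟩
  · simp
  · exfalso
    have h₁ := (binVal_append_bounds σ (b :: ρ)).2
    have h₂ := pow_mul_le_of_two_mul_le hk σ.length ρ.length
    have h₃ : (binVal σ + 1) * 2 ^ (b :: ρ).length ≤ k σ.length * 2 ^ (b :: ρ).length :=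
      Nat.mul_le_mul_right _ hσ
    rw [List.length_append, List.length_cons, ← add_assoc, dyadicLow] at hτ
    rw [List.length_cons, pow_succ, ← mul_assoc, ← mul_assoc] at h₃
    rw [List.length_cons, pow_succ, ← mul_assoc] at h₁
    omega

theorem exists_equiv_dyadicDomain {k : ℕ → ℕ} (hk : ∀ n, k n ≤ 2 ^ n) :
    ∃ e : (Σ n, Finset.Ico (dyadicLow k n) (k n)) ≃ dyadicDomain k,
      ∀ p, (e p).1.length = p.1 := by
  have hval : ∀ p : Σ n, Finset.Ico (dyadicLow k n) (k n),
      binVal (binStr p.1 p.2) = p.2 := fun p =>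
    binVal_binStr ((Finset.mem_Ico.1 p.2.2).2.trans_le (hk _))
  let g : (Σ n, Finset.Ico (dyadicLow k n) (k n)) → dyadicDomain k := fun p =>
    ⟨binStr p.1 p.2, by
      simpa only [dyadicDomain, Set.mem_ofPred_eq, length_binStr, hval] using
        Finset.mem_Ico.1 p.2.2⟩
  have hg : Function.Bijective g := by
    constructor
    · rintro ⟨m, i, hi⟩ ⟨n, j, hj⟩ h
      have h' : binStr m i = binStr n j := congrArg Subtype.val h
      obtain rfl : m = n := by
        simpa only [length_binStr] using congrArg List.length h'
      obtain rfl : i = j :=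
        (hval ⟨m, i, hi⟩).symm.trans ((congrArg binVal h').trans (hval ⟨m, j, hj⟩))
      rfl
    · rintro ⟨σ, hσ⟩
      exact ⟨⟨σ.length, binVal σ, Finset.mem_Ico.2 hσ⟩, Subtype.ext (binStr_binVal σ)⟩
  exact ⟨Equiv.ofBijective g hg, fun p => length_binStr _ _⟩

theorem sum_range_dyadicLow (k : ℕ → ℕ) (n : ℕ) :
    ∑ i ∈ Finset.range (n + 1), ((k i : ℝ) - dyadicLow k i) / 2 ^ i = (k n : ℝ) / 2 ^ n := by
  induction n with
  | zero => simp [dyadicLow]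
  | succ n ih =>
    rw [Finset.sum_range_succ, ih, dyadicLow]
    push_cast
    field_simp
    ring

theorem hasSum_dyadicDomain {k : ℕ → ℕ} {α : ℝ} (hk : ∀ n, 2 * k n ≤ k (n + 1))
    (hk' : ∀ n, k n ≤ 2 ^ n)
    (hα : Filter.Tendsto (fun n => (k n : ℝ) / 2 ^ n) Filter.atTop (nhds α)) :
    HasSum (fun σ : dyadicDomain k => (2 : ℝ) ^ (-(σ.1.length : ℤ))) α := by
  have hlow : ∀ n, dyadicLow k n ≤ k n := by
    rintro (_ | n)
    · exact Nat.zero_le _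
    · exact hk n
  obtain ⟨e, he⟩ := exists_equiv_dyadicDomain hk'
  rw [← e.hasSum_iff]
  have hfun : (fun σ : dyadicDomain k => (2 : ℝ) ^ (-(σ.1.length : ℤ))) ∘ e =
      fun p => ((2 : ℝ) ^ p.1)⁻¹ := by
    funext p
    simp [he]
  have hfib : ∀ n, HasSum (fun _ : Finset.Ico (dyadicLow k n) (k n) => ((2 : ℝ) ^ n)⁻¹)
      (((k n : ℝ) - dyadicLow k n) / 2 ^ n) := by
    intro n
    convert hasSum_fintype (fun _ : Finset.Ico (dyadicLow k n) (k n) => ((2 : ℝ) ^ n)⁻¹) using 1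
    simp [Nat.cast_sub (hlow n), div_eq_mul_inv]
  have hsum : HasSum (fun n => ((k n : ℝ) - dyadicLow k n) / 2 ^ n) α := by
    rw [hasSum_iff_tendsto_nat_of_nonneg, ← Filter.tendsto_add_atTop_iff_nat 1]
    · simpa only [sum_range_dyadicLow] using hα
    · exact fun n => div_nonneg (sub_nonneg.2 (by exact_mod_cast hlow n)) (by positivity)
  rw [hfun]
  refine HasSum.sigma_of_hasSum hsum hfib ?_
  rw [summable_sigma_of_nonneg fun _ => by positivity]
  exact ⟨fun n => (hfib n).summable, by simpa only [(hfib _).tsum_eq] using hsum.summable⟩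

theorem exists_machine_of_dyadic {k : ℕ → ℕ} {α : ℝ} (hc : Computable k)
    (hk : ∀ n, 2 * k n ≤ k (n + 1)) (hk' : ∀ n, k n ≤ 2 ^ n)
    (hα : Filter.Tendsto (fun n => (k n : ℝ) / 2 ^ n) Filter.atTop (nhds α)) :
    ∃ M : PFMachine, omegaOf M = α := by
  let o : List Bool → Option (List Bool) := fun σ =>
    bif decide (σ ∈ dyadicDomain k) then some [] else none
  have ho : Computable o :=
    Computable.cond (computablePred_dyadicDomain hc).decide (Computable.const _)
      (Computable.const _)
  have hdom : ∀ σ, ((o σ : Part (List Bool))).Dom ↔ σ ∈ dyadicDomain k := by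
    intro σ
    by_cases h : σ ∈ dyadicDomain k <;> simp [o, h]
  have hset : {σ | ((o σ : Part (List Bool))).Dom} = dyadicDomain k := Set.ext hdom
  refine ⟨⟨fun σ => o σ, ho.ofOption, hset ▸ prefixFreeSet_dyadicDomain hk⟩, ?_⟩
  rw [omegaOf, ← (hasSum_dyadicDomain hk hk' hα).tsum_eq]
  exact (Equiv.subtypeEquivRight hdom).tsum_eq
    (fun σ : dyadicDomain k => (2 : ℝ) ^ (-(σ.1.length : ℤ)))

/-- The binary truncation to `n` digits of the positive part of `q`, scaled by `2 ^ n`. -/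
def dyadicTrunc (q : ℚ) (n : ℕ) : ℕ := q.num.toNat * 2 ^ n / q.den

theorem dyadicTrunc_eq_floor (q : ℚ) (n : ℕ) :
    dyadicTrunc q n = ⌊max (q : ℝ) 0 * 2 ^ n⌋₊ := by
  have h : max (q : ℝ) 0 * 2 ^ n = ((q.num.toNat * 2 ^ n : ℕ) : ℝ) / (q.den : ℕ) := by
    have h₁ : max (q : ℝ) 0 = (q.num.toNat : ℝ) / q.den := by
      have h₂ : ((q.num.toNat : ℤ) : ℝ) = max (q.num : ℝ) 0 := by
        rw [Int.toNat_eq_max]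
        push_cast
        rfl
      rw [Int.cast_natCast] at h₂
      rw [h₂, ← max_div_div_right (Nat.cast_nonneg _), zero_div, ← Rat.cast_def]
    rw [h₁]
    push_cast
    ring
  rw [h, Nat.floor_div_eq_div, dyadicTrunc]

theorem primrec_two_pow : Primrec fun n : ℕ => 2 ^ n :=
  (Primrec₂.unpaired'.1 Nat.Primrec.pow).comp (Primrec.const 2) Primrec.id

theorem computable_dyadicTrunc {q : ℕ → ℚ} (hq : Computable q) :
    Computable fun n => dyadicTrunc (q n) n := by
  exact Primrec.nat_div.to_comp.comp
    (Primrec.nat_mul.to_comp.comp (computable_rat_num_toNat.comp hq) primrec_two_pow.to_comp)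
    (computable_rat_den.comp hq)

theorem LeftCE.exists_machine {α : ℝ} (hα : α ∈ Set.Icc (0 : ℝ) 1) (h : LeftCE α) :
    ∃ M : PFMachine, omegaOf M = α := by
  obtain ⟨q, hq, hmono, hlim⟩ := h
  have hmono' : Monotone fun n => (q n : ℝ) := fun _ _ hmn => Rat.cast_le.2 (hmono hmn)
  have hle : ∀ n, max (q n : ℝ) 0 ≤ 1 := fun n =>
    max_le ((hmono'.ge_of_tendsto hlim n).trans hα.2) zero_le_one
  have hmax : Filter.Tendsto (fun n => max (q n : ℝ) 0) Filter.atTop (nhds α) := by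
    simpa only [max_eq_left hα.1] using hlim.max (tendsto_const_nhds (x := (0 : ℝ)))
  refine exists_machine_of_dyadic (computable_dyadicTrunc hq) (fun n => ?_) (fun n => ?_) ?_
  · simp only [dyadicTrunc_eq_floor]
    refine Nat.le_floor ?_
    have h₁ := Nat.floor_le (a := max (q n : ℝ) 0 * 2 ^ n) (by positivity)
    have h₂ : max (q n : ℝ) 0 ≤ max (q (n + 1) : ℝ) 0 :=
      max_le_max_right 0 (hmono' n.le_succ)
    push_cast
    calc (2 : ℝ) * ⌊max (q n : ℝ) 0 * 2 ^ n⌋₊ ≤ 2 * (max (q n : ℝ) 0 * 2 ^ n) := by gcongr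
      _ = max (q n : ℝ) 0 * 2 ^ (n + 1) := by ring
      _ ≤ max (q (n + 1) : ℝ) 0 * 2 ^ (n + 1) := by gcongr
  · rw [dyadicTrunc_eq_floor]
    refine Nat.floor_le_of_le ?_
    push_cast
    exact mul_le_of_le_one_left (by positivity) (hle n)
  · have hpow : Filter.Tendsto (fun n : ℕ => ((1 : ℝ) / 2) ^ n) Filter.atTop (nhds 0) :=
      tendsto_pow_atTop_nhds_zero_of_lt_one (by norm_num) (by norm_num)
    refine tendsto_of_tendsto_of_tendsto_of_le_of_le
      (by simpa only [sub_zero] using hmax.sub hpow) hmax (fun n => ?_) (fun n => ?_)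
    · have h₁ := Nat.lt_floor_add_one (max (q n : ℝ) 0 * 2 ^ n)
      simp only [dyadicTrunc_eq_floor]
      rw [le_div_iff₀ (by positivity), sub_mul, ← mul_pow]
      norm_num
      linarith
    · simp only [dyadicTrunc_eq_floor]
      rw [div_le_iff₀ (by positivity)]
      exact Nat.floor_le (by positivity)

/-! ### Halting probabilities are left-c.e. -/

/-- The scaled contribution `2 ^ (t - |σ|)` of the string `σ` with code `n` to the halting
probability at stage `t`, provided that `c` halts on `n` within `t` steps and `|σ| ≤ t`. -/
def stageWeight (c : Nat.Partrec.Code) (t n : ℕ) : ℕ :=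
  bif (c.evaln t n).isSome then
    ((decode₂ (List Bool) n).bind fun σ =>
      bif decide (σ.length ≤ t) then some (2 ^ (t - σ.length)) else none).getD 0
  else 0

/-- The lower bound at stage `t` for the halting probability, scaled by `2 ^ t`. -/
def stageSum (c : Nat.Partrec.Code) (t : ℕ) : ℕ :=
  ∑ n ∈ Finset.range t, stageWeight c t n

theorem primrec_stageWeight (c : Nat.Partrec.Code) : Primrec₂ (stageWeight c) := by
  have h₁ : Primrec fun p : ℕ × ℕ => (c.evaln p.1 p.2).isSome :=
    Primrec.option_isSome.comp (Nat.Partrec.Code.primrec_evaln.comp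
      (Primrec.pair (Primrec.pair Primrec.fst (Primrec.const c)) Primrec.snd))
  have hlen : Primrec fun p : (ℕ × ℕ) × List Bool => p.2.length :=
    Primrec.list_length.comp Primrec.snd
  have ht : Primrec fun p : (ℕ × ℕ) × List Bool => p.1.1 := Primrec.fst.comp Primrec.fst
  have h₂ : Primrec₂ fun (p : ℕ × ℕ) (σ : List Bool) =>
      bif decide (σ.length ≤ p.1) then some (2 ^ (p.1 - σ.length)) else none :=
    Primrec.cond (Primrec.nat_le.comp hlen ht).decide
      (Primrec.option_some.comp (primrec_two_pow.comp (Primrec.nat_sub.comp ht hlen)))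
      (Primrec.const none)
  exact Primrec.cond h₁ (Primrec.option_getD.comp
    (Primrec.option_bind (Primrec.decode₂.comp Primrec.snd) h₂) (Primrec.const 0))
    (Primrec.const 0)

theorem Primrec₂.sum_range {f : ℕ → ℕ → ℕ} (hf : Primrec₂ f) :
    Primrec fun t => ∑ n ∈ Finset.range t, f t n := by
  have h : Primrec₂ fun (t : ℕ) (p : ℕ × ℕ) => p.2 + f t p.1 :=
    Primrec.nat_add.comp (Primrec.snd.comp Primrec.snd)
      (hf.comp Primrec.fst (Primrec.fst.comp Primrec.snd))
  refine (Primrec.nat_rec' Primrec.id (Primrec.const 0) h).of_eq fun t => ?_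
  suffices ∀ m, Nat.rec (motive := fun _ => ℕ) 0 (fun n s => s + f t n) m =
      ∑ n ∈ Finset.range m, f t n from this t
  intro m
  induction m with
  | zero => rfl
  | succ m ih => rw [Finset.sum_range_succ, ← ih]

theorem computable_stageSum_div (c : Nat.Partrec.Code) :
    Computable fun t => (stageSum c t : ℚ) / 2 ^ t := by
  have h := computable_natCast_div (primrec_stageWeight c).sum_range.to_comp
    primrec_two_pow.to_comp fun n => by positivity
  exact h.of_eq fun t => by simp [stageSum]

theorem PFMachine.exists_code (M : PFMachine) :
    ∃ c : Nat.Partrec.Code, ∀ σ, (M.f σ).Dom ↔ ∃ t, (c.evaln t (encode σ)).isSome := by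
  obtain ⟨c, hc⟩ := Nat.Partrec.Code.exists_code.1 M.partrec
  refine ⟨c, fun σ => ?_⟩
  have hdom : (M.f σ).Dom ↔ (c.eval (encode σ)).Dom := by simp [hc]
  rw [hdom, Part.dom_iff_mem]
  simp only [Nat.Partrec.Code.evaln_complete, Option.isSome_iff_exists, Option.mem_def]
  exact exists_comm

/-- The strings of length and code bounded by `t` on which `c` halts within `t` steps. -/
def stageSet (c : Nat.Partrec.Code) (t : ℕ) : Set (List Bool) :=
  {σ | encode σ < t ∧ σ.length ≤ t ∧ (c.evaln t (encode σ)).isSome}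

theorem stageSet_mono (c : Nat.Partrec.Code) : Monotone (stageSet c) := by
  rintro s t hst σ ⟨h₁, h₂, h₃⟩
  obtain ⟨x, hx⟩ := Option.isSome_iff_exists.1 h₃
  exact ⟨h₁.trans_le hst, h₂.trans hst,
    Option.isSome_iff_exists.2 ⟨x, Nat.Partrec.Code.evaln_mono hst hx⟩⟩

theorem finite_stageSet (c : Nat.Partrec.Code) (t : ℕ) : (stageSet c t).Finite :=
  ((Set.finite_Iio t).preimage encode_injective.injOn).subset fun _ h => h.1

theorem stageWeight_encode {c : Nat.Partrec.Code} {t : ℕ} {σ : List Bool} (h : σ ∈ stageSet c t) :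
    (stageWeight c t (encode σ) : ℝ) / 2 ^ t = 2 ^ (-(σ.length : ℤ)) := by
  obtain ⟨-, h₂, h₃⟩ := h
  simp only [stageWeight, h₃, encodek₂, h₂, decide_true, Option.bind_some, cond_true,
    Option.getD_some]
  rw [zpow_neg, zpow_natCast]
  push_cast
  rw [div_eq_iff (by positivity), inv_mul_eq_div, eq_div_iff (by positivity), ← pow_add,
    Nat.sub_add_cancel h₂]

theorem exists_mem_stageSet_of_stageWeight_ne_zero {c : Nat.Partrec.Code} {t n : ℕ} (hn : n < t)
    (h : stageWeight c t n ≠ 0) : ∃ σ ∈ stageSet c t, encode σ = n := by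
  unfold stageWeight at h
  cases h₁ : (c.evaln t n).isSome
  · simp [h₁] at h
  cases h₂ : decode₂ (List Bool) n with
  | none => simp [h₂] at h
  | some σ =>
    obtain rfl : encode σ = n := decode₂_eq_some.1 h₂
    by_cases h₃ : σ.length ≤ t
    · exact ⟨σ, ⟨hn, h₃, h₁⟩, rfl⟩
    · simp [h₂, h₃] at h

theorem stageSum_div (c : Nat.Partrec.Code) (t : ℕ) :
    (stageSum c t : ℝ) / 2 ^ t =
      ∑ σ ∈ (finite_stageSet c t).toFinset, (2 : ℝ) ^ (-(σ.length : ℤ)) := by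
  rw [stageSum, Nat.cast_sum, Finset.sum_div]
  symm
  refine Finset.sum_of_injOn encode encode_injective.injOn (fun σ h => ?_) (fun n hn hσ => ?_)
    fun σ h => ?_
  · exact Finset.mem_coe.2 (Finset.mem_range.2 ((Set.Finite.mem_toFinset _).1 h).1)
  · rw [div_eq_zero_iff, Nat.cast_eq_zero]
    left
    by_contra h
    obtain ⟨σ, hmem, rfl⟩ := exists_mem_stageSet_of_stageWeight_ne_zero (Finset.mem_range.1 hn) h
    exact hσ ⟨σ, by simpa using hmem, rfl⟩
  · exact (stageWeight_encode ((Set.Finite.mem_toFinset _).1 h)).symm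

theorem leftCE_omegaOf (M : PFMachine) : LeftCE (omegaOf M) := by
  by_cases hs : Summable fun σ : {σ : List Bool // (M.f σ).Dom} =>
      (2 : ℝ) ^ (-(σ.1.length : ℤ))
  · obtain ⟨c, hc⟩ := M.exists_code
    have hsub : ∀ {t σ}, σ ∈ stageSet c t → (M.f σ).Dom := fun h => (hc _).2 ⟨_, h.2.2⟩
    have hfin : ∀ t, (Subtype.val ⁻¹' stageSet c t : Set {σ // (M.f σ).Dom}).Finite :=
      fun t => (finite_stageSet c t).preimage Subtype.val_injective.injOn
    have hsum : ∀ t, (stageSum c t : ℝ) / 2 ^ t =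
        ∑ σ ∈ (hfin t).toFinset, (2 : ℝ) ^ (-(σ.1.length : ℤ)) := by
      intro t
      rw [stageSum_div]
      symm
      refine Finset.sum_of_injOn Subtype.val Subtype.val_injective.injOn (fun σ h => ?_)
        (fun σ h hσ => ?_) fun _ _ => rfl
      · simpa using h
      · rw [Set.Finite.mem_toFinset] at h
        exact (hσ ⟨⟨σ, hsub h⟩, by simpa using h, rfl⟩).elim
    have hmono : Monotone fun t => (hfin t).toFinset := fun s t hst =>
      Set.Finite.toFinset_subset_toFinset.2 (Set.preimage_mono (stageSet_mono c hst))
    have hcover : ∀ σ, ∃ t, σ ∈ (hfin t).toFinset := by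
      rintro ⟨σ, hσ⟩
      obtain ⟨s, hs⟩ := (hc σ).1 hσ
      obtain ⟨x, hx⟩ := Option.isSome_iff_exists.1 hs
      refine ⟨s + (encode σ + 1) + σ.length, ?_⟩
      simp only [Set.Finite.mem_toFinset, Set.mem_preimage]
      exact ⟨by omega, by omega, Option.isSome_iff_exists.2
        ⟨x, Nat.Partrec.Code.evaln_mono (by omega) hx⟩⟩
    refine ⟨fun t => (stageSum c t : ℚ) / 2 ^ t, computable_stageSum_div c, ?_, ?_⟩
    · intro s t hst
      rw [← Rat.cast_le (K := ℝ)]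
      push_cast
      rw [hsum, hsum]
      exact Finset.sum_le_sum_of_subset_of_nonneg (hmono hst) fun _ _ _ => by positivity
    · push_cast
      simp only [hsum]
      exact hs.hasSum.comp (Filter.tendsto_atTop_finset_of_monotone hmono hcover)
  · rw [omegaOf, tsum_eq_zero_of_not_summable hs]
    exact ⟨fun _ => 0, Computable.const 0, monotone_const, by simp⟩

/-- A real number α in [0,1] is left-c.e. iff α = Ω_M for some
prefix-free machine M. -/
theorem stmt_0 (α : ℝ) (hα : α ∈ Set.Icc (0:ℝ) 1) :
    LeftCE α ↔ ∃ M : PFMachine, omegaOf M = α := by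
  exact ⟨fun h => h.exists_machine hα, fun ⟨M, hM⟩ => hM ▸ leftCE_omegaOf M⟩
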